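/- Let K ⊆ Σ* be a regular trace-closed language and let L = [lim(K)]_{≈_I}. Then there exist a finite monoid S, a monoid homomorphism φ: Σ* → S that is constant on ∼_I-classes, and a set P ⊆ S with K = φ^{-1}(P), such that φ saturates L: for every linked pair (s,e) of S, either φ^{-1}(s)·(φ^{-1}(e))^ω ∩ L = ∅ or φ^{-1}(s)·(φ^{-1}(e))^ω ⊆ L. -/

import Mathlib

open Relation

variable {A : Type*} {σ : Type*} {S : Type*}

/-- The length-`n` prefix of an ω-word. -/
def wpre (α : ℕ → A) (n : ℕ) : List A := (List.range n).map α

/-- One swap of two adjacent independent letters. -/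
def SwapStep (I : A → A → Prop) (u v : List A) : Prop :=
  ∃ (x y : List A) (a b : A), I a b ∧ u = x ++ a :: b :: y ∧ v = x ++ b :: a :: y

/-- Trace equivalence `∼_I` on finite words: the equivalence closure of adjacent swaps. -/
def TrEq (I : A → A → Prop) : List A → List A → Prop := EqvGen (SwapStep I)

/-- Trace-prefix relation `u ⊑_I v`. -/
def TrPre (I : A → A → Prop) (u v : List A) : Prop := ∃ w, TrEq I (u ++ w) v

/-- Trace equivalence `≈_I` of ω-words. -/
def OmEq (I : A → A → Prop) (α β : ℕ → A) : Prop :=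
  (∀ n, ∃ m, TrPre I (wpre α n) (wpre β m)) ∧ (∀ n, ∃ m, TrPre I (wpre β n) (wpre α m))

/-- A language of finite words is trace-closed. -/
def TraceClosed (I : A → A → Prop) (K : Set (List A)) : Prop :=
  ∀ u v, u ∈ K → TrEq I u v → v ∈ K

/-- An ω-language is trace-closed. -/
def OmTraceClosed (I : A → A → Prop) (L : Set (ℕ → A)) : Prop :=
  ∀ α β, α ∈ L → OmEq I α β → β ∈ L

/-- `ext(K)`: ω-words with some finite prefix in `K`. -/
def extL (K : Set (List A)) : Set (ℕ → A) := {α | ∃ n, wpre α n ∈ K}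

/-- `lim(K)`: ω-words with infinitely many finite prefixes in `K`. -/
def limL (K : Set (List A)) : Set (ℕ → A) := {α | ∀ N, ∃ n ≥ N, wpre α n ∈ K}

/-- `[L]_{≈_I}`: the ω-trace closure of an ω-language. -/
def omCl (I : A → A → Prop) (L : Set (ℕ → A)) : Set (ℕ → A) := {α | ∃ β ∈ L, OmEq I α β}

/-- The `I`-suffix extension `K_I`. -/
def suffExt (I : A → A → Prop) (K : Set (List A)) : Set (List A) :=
  K ∪ {w | ∃ (a : A) (u x : List A),
    u ++ [a] ∈ K ∧ (∀ b ∈ x, I a b) ∧ TrEq I w (u ++ [a] ++ x)}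

/-- A language is regular iff it is recognized by a DFA with finitely many states. -/
def RegularLang (K : Set (List A)) : Prop :=
  ∃ (σ : Type) (_ : Fintype σ) (M : DFA A σ), ∀ w, w ∈ M.accepts ↔ w ∈ K

/-- A DFA is `I`-diamond. -/
def IDiamond (I : A → A → Prop) (M : DFA A σ) : Prop :=
  ∀ q a b, I a b → M.step (M.step q a) b = M.step (M.step q b) a

/-- The ω-language of a DFA viewed as a deterministic Büchi automaton. -/
def BuchiLang (M : DFA A σ) : Set (ℕ → A) :=
  {α | ∀ N, ∃ n ≥ N, M.evalFrom M.start (wpre α n) ∈ M.accept}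

/-- The weakness condition: mutually reachable states agree on acceptance. -/
def IsWeak (M : DFA A σ) : Prop :=
  ∀ q q', (∃ u, M.evalFrom q u = q') → (∃ v, M.evalFrom q' v = q) →
    (q ∈ M.accept ↔ q' ∈ M.accept)

/-- States visited infinitely often by the run of a DFA on an ω-word. -/
def InfStates (M : DFA A σ) (α : ℕ → A) : Set σ :=
  {q | ∀ N, ∃ n ≥ N, M.evalFrom M.start (wpre α n) = q}

/-- The ω-language of a DFA equipped with a Muller acceptance family. -/
def MullerLang (M : DFA A σ) (F : Set (Set σ)) : Set (ℕ → A) := {α | InfStates M α ∈ F}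

/-- An ω-language is ω-regular iff it is recognized by a deterministic Muller automaton. -/
def OmegaRegular (L : Set (ℕ → A)) : Prop :=
  ∃ (σ : Type) (_ : Fintype σ) (M : DFA A σ) (F : Set (Set σ)), MullerLang M F = L

/-- Finite Boolean combinations of a family of sets. -/
inductive BoolComb {X : Type*} (G : Set (Set X)) : Set X → Prop
  | base {L} : L ∈ G → BoolComb G L
  | compl {L} : BoolComb G L → BoolComb G Lᶜ
  | union {L₁ L₂} : BoolComb G L₁ → BoolComb G L₂ → BoolComb G (L₁ ∪ L₂)
  | inter {L₁ L₂} : BoolComb G L₁ → BoolComb G L₂ → BoolComb G (L₁ ∩ L₂)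

/-- `φ : Σ* → S` is a monoid homomorphism (words under concatenation). -/
def IsHom [Monoid S] (φ : List A → S) : Prop :=
  φ [] = 1 ∧ ∀ u v, φ (u ++ v) = φ u * φ v

/-- Linked pair of a monoid. -/
def LinkedPair [Monoid S] (s e : S) : Prop := s * e = s ∧ e * e = e

/-- The factor `α[i, j)` of an ω-word. -/
def seg (α : ℕ → A) (i j : ℕ) : List A := (List.range (j - i)).map (fun k => α (i + k))

/-- `φ⁻¹(s)·(φ⁻¹(e))^ω`: ω-words admitting a factorization `u·v₁·v₂⋯` with
`φ(u) = s` and `φ(vᵢ) = e`. -/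
def LPWords (φ : List A → S) (s e : S) : Set (ℕ → A) :=
  {α | ∃ n : ℕ → ℕ, StrictMono n ∧ φ (wpre α (n 0)) = s ∧
    ∀ i, φ (seg α (n i) (n (i + 1))) = e}

/-- `φ` saturates an ω-language `L`. -/
def Saturates [Monoid S] (φ : List A → S) (L : Set (ℕ → A)) : Prop :=
  ∀ s e : S, LinkedPair s e → LPWords φ s e ∩ L = ∅ ∨ LPWords φ s e ⊆ L

/-- The `P`-cut property of a linked pair `(s, e)` with respect to `φ`. -/
def PCut [Monoid S] (φ : List A → S) (P : Set S) (s e : S) : Prop :=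
  (∀ w : List A, w ≠ [] → φ w = e →
      ∃ j, 1 ≤ j ∧ j ≤ w.length ∧ s * e * φ (w.take j) ∈ P) ∨
  (∀ w : List A, w ≠ [] → φ w = e →
      ∀ j, 1 ≤ j → j ≤ w.length → s * e * φ (w.take j) ∉ P)

/-- The run from `q` on `u` visits an accepting state (endpoints included). -/
def VisitsAcc (M : DFA A σ) (q : σ) (u : List A) : Prop :=
  ∃ p, p <+: u ∧ M.evalFrom q p ∈ M.accept

/-- `q ⇒_u q'`: the run from `q` on `u` ends in `q'` and visits an accepting state. -/
def FICycleClosed (I : A → A → Prop) (M : DFA A σ) : Prop :=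
  ∀ u v q, TrEq I u v →
    ((M.evalFrom q u = q ∧ VisitsAcc M q u) ↔ (M.evalFrom q v = q ∧ VisitsAcc M q v))

theorem TrEq.refl' (I : A → A → Prop) (u : List A) : TrEq I u u := EqvGen.refl _

theorem TrEq.symm' {I : A → A → Prop} {u v : List A} (h : TrEq I u v) : TrEq I v u :=
  EqvGen.symm _ _ h

theorem TrEq.trans' {I : A → A → Prop} {u v w : List A} (h : TrEq I u v) (h' : TrEq I v w) :
    TrEq I u w := EqvGen.trans _ _ _ h h'

theorem TrEq.ctx {I : A → A → Prop} {u v : List A} (x y : List A) (h : TrEq I u v) :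
    TrEq I (x ++ u ++ y) (x ++ v ++ y) := by
  induction h with
  | rel u v h =>
    obtain ⟨p, q, a, b, hab, rfl, rfl⟩ := h
    exact EqvGen.rel _ _ ⟨x ++ p, q ++ y, a, b, hab, by simp, by simp⟩
  | refl u => exact EqvGen.refl _
  | symm u v _ ih => exact ih.symm'
  | trans u v w _ _ ih1 ih2 => exact ih1.trans' ih2

theorem TrEq.app {I : A → A → Prop} {u v x y : List A} (h : TrEq I u v) (h' : TrEq I x y) :
    TrEq I (u ++ x) (v ++ y) := by
  have h1 := TrEq.ctx [] x h
  have h2 := TrEq.ctx v [] h'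
  simp only [List.nil_append, List.append_nil] at h1 h2
  exact h1.trans' h2

theorem TrEq.perm {I : A → A → Prop} {u v : List A} (h : TrEq I u v) : u.Perm v := by
  induction h with
  | rel u v h =>
    obtain ⟨p, q, a, b, hab, rfl, rfl⟩ := h
    exact List.Perm.append_left _ (List.Perm.swap _ _ _)
  | refl u => exact List.Perm.refl _
  | symm u v _ ih => exact ih.symm
  | trans u v w _ _ ih1 ih2 => exact ih1.trans ih2

theorem TrEq.ind {I : A → A → Prop} (hsym : ∀ a b, I a b → I b a) (Q : List A → Prop)
    (hQ : ∀ u v, SwapStep I u v → Q u → Q v) {u v : List A} (h : TrEq I u v) : Q u ↔ Q v := by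
  induction h with
  | rel u v h =>
    refine ⟨hQ _ _ h, hQ _ _ ?_⟩
    obtain ⟨p, q, a, b, hab, rfl, rfl⟩ := h
    exact ⟨p, q, b, a, hsym _ _ hab, rfl, rfl⟩
  | refl u => exact Iff.rfl
  | symm u v _ ih => exact ih.symm
  | trans u v w _ _ ih1 ih2 => exact ih1.trans ih2

theorem TrEq.swap {I : A → A → Prop} {a b : A} (x y : List A) (h : I a b) :
    TrEq I (x ++ a :: b :: y) (x ++ b :: a :: y) := EqvGen.rel _ _ ⟨x, y, a, b, h, rfl, rfl⟩

theorem TrEq.comm1 {I : A → A → Prop} (a : A) (x : List A) (h : ∀ b ∈ x, I b a) :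
    TrEq I (x ++ [a]) (a :: x) := by
  induction x with
  | nil => exact EqvGen.refl _
  | cons b x ih =>
    have h1 := TrEq.ctx [b] [] (ih fun c hc => h c (List.mem_cons_of_mem _ hc))
    have h2 := TrEq.swap [] x (h b (List.mem_cons_self))
    simp only [List.append_nil, List.nil_append, List.cons_append] at h1 h2 ⊢
    exact h1.trans' h2

theorem TrEq.comm {I : A → A → Prop} (x y : List A) (h : ∀ b ∈ x, ∀ a ∈ y, I b a) :
    TrEq I (x ++ y) (y ++ x) := by
  induction y with
  | nil => simpa using TrEq.refl' I _
  | cons a y ih =>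
    have h1 := TrEq.ctx [] y (TrEq.comm1 a x fun b hb => h b hb a List.mem_cons_self)
    have h2 := TrEq.ctx [a] [] (ih fun b hb c hc => h b hb c (List.mem_cons_of_mem _ hc))
    simp only [List.append_nil, List.nil_append, List.cons_append, List.append_assoc] at h1 h2 ⊢
    exact h1.trans' h2

def HasFirst (I : A → A → Prop) (a : A) (x z : List A) : Prop :=
  ∃ z1 z2, z = z1 ++ a :: z2 ∧ (∀ b ∈ z1, I b a) ∧ TrEq I (z1 ++ z2) x

theorem HasFirst.step {I : A → A → Prop} (hsym : ∀ a b, I a b → I b a) (a : A) (x : List A)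
    (u v : List A) (h : SwapStep I u v) (hu : HasFirst I a x u) : HasFirst I a x v := by
  obtain ⟨X, Y, b, c, hbc, rfl, rfl⟩ := h
  obtain ⟨z1, z2, he, hz, ht⟩ := hu
  rw [List.append_eq_append_iff] at he
  rcases he with ⟨w, rfl, hw⟩ | ⟨w, rfl, hw⟩
  · -- z1 = X ++ w
    rcases w with _ | ⟨d, w⟩
    · simp only [List.nil_append, List.cons.injEq] at hw
      obtain ⟨rfl, rfl⟩ := hw
      refine ⟨X ++ [c], Y, by simp, ?_, ?_⟩
      · intro d hd
        rcases List.mem_append.1 hd with hd | hd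
        · exact hz d (by simpa using hd)
        · simp only [List.mem_singleton] at hd
          subst hd; exact hsym _ _ hbc
      · simpa using ht
    · rcases w with _ | ⟨d', w⟩
      · simp only [List.cons_append, List.nil_append, List.cons.injEq] at hw
        obtain ⟨rfl, rfl, rfl⟩ := hw
        refine ⟨X, b :: Y, by simp, fun d hd => hz d (by simp [hd]), by simpa using ht⟩
      · simp only [List.cons_append, List.cons.injEq] at hw
        obtain ⟨rfl, rfl, rfl⟩ := hw
        refine ⟨X ++ c :: b :: w, z2, by simp, fun d hd => hz d ?_, ?_⟩
        · simp only [List.mem_append, List.mem_cons] at hd ⊢; tauto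
        · refine TrEq.trans' ?_ ht
          have := TrEq.swap X (w ++ z2) (hsym _ _ hbc)
          simpa using this
  · -- X = z1 ++ w
    rcases w with _ | ⟨d, w⟩
    · simp only [List.nil_append, List.cons.injEq] at hw
      obtain ⟨rfl, rfl⟩ := hw
      refine ⟨z1 ++ [c], Y, by simp, ?_, by simpa using ht⟩
      intro d hd
      rcases List.mem_append.1 hd with hd | hd
      · exact hz d (by simpa using hd)
      · simp only [List.mem_singleton] at hd
        subst hd; exact hsym _ _ hbc
    · simp only [List.cons_append, List.cons.injEq] at hw
      obtain ⟨rfl, rfl⟩ := hw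
      refine ⟨z1, w ++ c :: b :: Y, by simp, hz, TrEq.trans' ?_ ht⟩
      have := TrEq.swap (z1 ++ w) Y (hsym _ _ hbc)
      simpa using this

theorem TrEq.hasFirst {I : A → A → Prop} (hsym : ∀ a b, I a b → I b a) {a : A} {x z : List A}
    (h : TrEq I (a :: x) z) : HasFirst I a x z :=
  (TrEq.ind hsym (HasFirst I a x) (HasFirst.step hsym a x) h).1
    ⟨[], x, rfl, by simp, EqvGen.refl _⟩

theorem TrEq.cancel {I : A → A → Prop} (hirr : ∀ a, ¬ I a a) (hsym : ∀ a b, I a b → I b a)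
    (u : List A) {x y : List A} (h : TrEq I (u ++ x) (u ++ y)) : TrEq I x y := by
  induction u with
  | nil => exact h
  | cons a u ih =>
    apply ih
    obtain ⟨z1, z2, he, hz, ht⟩ := TrEq.hasFirst hsym h
    rcases z1 with _ | ⟨b, z1⟩
    · simp only [List.nil_append, List.cons_append, List.cons.injEq, true_and] at he ht
      rw [he]; exact ht.symm'
    · simp only [List.cons_append, List.cons.injEq] at he
      exact absurd (hz b List.mem_cons_self) (by rw [← he.1]; exact hirr a)

/-- Levi factorization of a split word against `u ++ v`. -/
def LeviQ (I : A → A → Prop) (u v w : List A) : Prop :=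
  ∀ p r, w = p ++ r → ∃ p1 r1 p2 r2, TrEq I u (p1 ++ r1) ∧ TrEq I v (p2 ++ r2) ∧
    TrEq I p (p1 ++ p2) ∧ TrEq I r (r1 ++ r2) ∧ ∀ b ∈ r1, ∀ a ∈ p2, I b a

theorem LeviQ.step {I : A → A → Prop} (hsym : ∀ a b, I a b → I b a) (u v : List A)
    (w w' : List A) (h : SwapStep I w w') (hw : LeviQ I u v w) : LeviQ I u v w' := by
  obtain ⟨X, Y, a, b, hab, rfl, rfl⟩ := h
  intro p r he
  rw [List.append_eq_append_iff] at he
  rcases he with ⟨t, rfl, ht⟩ | ⟨t, rfl, ht⟩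
  · rcases t with _ | ⟨d, t⟩
    · -- p = X
      simp only [List.nil_append] at ht
      subst ht
      obtain ⟨p1, r1, p2, r2, h1, h2, h3, h4, h5⟩ := hw X (a :: b :: Y) rfl
      exact ⟨p1, r1, p2, r2, h1, h2, by simpa using h3,
        (TrEq.swap [] Y (hsym _ _ hab)).trans' h4, h5⟩
    · rcases t with _ | ⟨d', t⟩
      · -- p = X ++ [b], r = a :: Y
        simp only [List.cons_append, List.nil_append, List.cons.injEq] at ht
        obtain ⟨rfl, rfl⟩ := ht
        obtain ⟨p1, r1, p2, r2, h1, h2, h3, h4, h5⟩ := hw X (a :: b :: Y) rfl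
        have h6 := (TrEq.swap [] Y (hsym _ _ hab)).trans' h4
        obtain ⟨z1, z2, he, hz, ht⟩ := TrEq.hasFirst hsym h6
        rw [List.append_eq_append_iff] at he
        have key1 : ∀ r1', r1 = z1 ++ b :: r1' → z2 = r1' ++ r2 → ∃ p1 r1 p2 r2,
            TrEq I u (p1 ++ r1) ∧ TrEq I v (p2 ++ r2) ∧
            TrEq I (X ++ [b]) (p1 ++ p2) ∧ TrEq I (a :: Y) (r1 ++ r2) ∧
            ∀ b ∈ r1, ∀ a ∈ p2, I b a := by
          rintro r1' rfl rfl
          refine ⟨p1 ++ [b], z1 ++ r1', p2, r2, ?_, h2, ?_, ?_, ?_⟩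
          · have := TrEq.ctx p1 r1' (TrEq.comm1 b z1 hz)
            simp only [List.append_assoc, List.cons_append, List.nil_append] at this h1 ⊢
            exact h1.trans' this
          · have k1 := TrEq.ctx [] [b] h3
            have k2 := TrEq.ctx p1 [] (TrEq.comm1 b p2 fun c hc => hsym _ _ (h5 b (by simp) c hc))
            simp only [List.append_assoc, List.cons_append, List.nil_append, List.append_nil]
              at k1 k2 ⊢
            exact k1.trans' k2
          · simpa using ht.symm'
          · intro c hc; apply h5 c; simp only [List.mem_append, List.mem_cons] at hc ⊢; tauto
        have key2 : ∀ z, z1 = r1 ++ z → r2 = z ++ b :: z2 → ∃ p1 r1 p2 r2,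
            TrEq I u (p1 ++ r1) ∧ TrEq I v (p2 ++ r2) ∧
            TrEq I (X ++ [b]) (p1 ++ p2) ∧ TrEq I (a :: Y) (r1 ++ r2) ∧
            ∀ b ∈ r1, ∀ a ∈ p2, I b a := by
          rintro z rfl rfl
          refine ⟨p1, r1, p2 ++ [b], z ++ z2, h1, ?_, ?_, ?_, ?_⟩
          · have := TrEq.ctx p2 z2 (TrEq.comm1 b z fun c hc => hz c (by simp [hc]))
            simp only [List.append_assoc, List.cons_append, List.nil_append] at this h2 ⊢
            exact h2.trans' this
          · have k1 := TrEq.ctx [] [b] h3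
            simpa using k1
          · simpa using ht.symm'
          · intro c hc d hd
            rcases List.mem_append.1 hd with hd | hd
            · exact h5 c hc d hd
            · simp only [List.mem_singleton] at hd
              subst hd; exact hz c (by simp [hc])
        rcases he with ⟨t, ht1, ht2⟩ | ⟨t, ht1, ht2⟩
        · exact key2 t ht1 ht2
        · rcases t with _ | ⟨d, t⟩
          · exact key2 [] (by simpa using ht1.symm) (by simpa using ht2.symm)
          · simp only [List.cons_append, List.cons.injEq] at ht2
            obtain ⟨rfl, rfl⟩ := ht2
            exact key1 t ht1 rfl
      · simp only [List.cons_append, List.cons.injEq] at ht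
        obtain ⟨rfl, rfl, rfl⟩ := ht
        obtain ⟨p1, r1, p2, r2, h1, h2, h3, h4, h5⟩ := hw (X ++ a :: b :: t) r (by simp)
        exact ⟨p1, r1, p2, r2, h1, h2, (TrEq.swap X t (hsym _ _ hab)).trans' h3, h4, h5⟩
  · subst ht
    obtain ⟨p1, r1, p2, r2, h1, h2, h3, h4, h5⟩ := hw p (t ++ a :: b :: Y) (by simp)
    exact ⟨p1, r1, p2, r2, h1, h2, h3, (TrEq.swap t Y (hsym _ _ hab)).trans' h4, h5⟩

theorem TrEq.levi {I : A → A → Prop} (hsym : ∀ a b, I a b → I b a) {u v p r : List A}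
    (h : TrEq I (u ++ v) (p ++ r)) : ∃ p1 r1 p2 r2, TrEq I u (p1 ++ r1) ∧ TrEq I v (p2 ++ r2) ∧
    TrEq I p (p1 ++ p2) ∧ TrEq I r (r1 ++ r2) ∧ ∀ b ∈ r1, ∀ a ∈ p2, I b a := by
  refine (TrEq.ind hsym (LeviQ I u v) (LeviQ.step hsym u v) h).1 ?_ p r rfl
  intro p r he
  rw [List.append_eq_append_iff] at he
  rcases he with ⟨t, rfl, rfl⟩ | ⟨t, rfl, rfl⟩
  · exact ⟨u, [], t, r, by simpa using TrEq.refl' I _, EqvGen.refl _, EqvGen.refl _,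
      EqvGen.refl _, by simp⟩
  · exact ⟨p, t, [], v, EqvGen.refl _, EqvGen.refl _, by simpa using TrEq.refl' I _,
      EqvGen.refl _, by simp⟩

def ctxSet (K : Set (List A)) (u : List A) : Set (List A × List A) := {t | t.1 ++ u ++ t.2 ∈ K}

def factSet (I : A → A → Prop) (K : Set (List A)) (u : List A) :
    Set (Set.range (ctxSet K) × Set A × Set A) :=
  {t | ∃ p r, TrEq I u (p ++ r) ∧ t = (⟨ctxSet K p, p, rfl⟩, {a | a ∈ p}, {a | a ∈ r})}

theorem ctxSet_app {K : Set (List A)} {u u' v v' : List A} (h : ctxSet K u = ctxSet K u')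
    (h' : ctxSet K v = ctxSet K v') : ctxSet K (u ++ v) = ctxSet K (u' ++ v') := by
  ext ⟨x, y⟩
  have h1 := Set.ext_iff.1 h (x, v ++ y)
  have h2 := Set.ext_iff.1 h' (x ++ u', y)
  simp only [ctxSet, Set.mem_ofPred_eq, List.append_assoc] at h1 h2 ⊢
  exact h1.trans h2

theorem ctxSet_tr {I : A → A → Prop} {K : Set (List A)} (hK : TraceClosed I K) {u v : List A}
    (h : TrEq I u v) : ctxSet K u = ctxSet K v := by
  ext ⟨x, y⟩
  exact ⟨fun h1 => hK _ _ h1 (TrEq.ctx x y h), fun h1 => hK _ _ h1 (TrEq.ctx x y h.symm')⟩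

theorem ctxSet_mem {K : Set (List A)} {u v : List A} (h : ctxSet K u = ctxSet K v) :
    u ∈ K ↔ v ∈ K := by
  have h1 := Set.ext_iff.1 h ([], [])
  simpa [ctxSet] using h1

theorem factSet_tr {I : A → A → Prop} {K : Set (List A)} {u v : List A}
    (h : TrEq I u v) : factSet I K u = factSet I K v := by
  ext t
  constructor
  · rintro ⟨p, r, h1, rfl⟩; exact ⟨p, r, h.symm'.trans' h1, rfl⟩
  · rintro ⟨p, r, h1, rfl⟩; exact ⟨p, r, h.trans' h1, rfl⟩

theorem factSet_use {I : A → A → Prop} {K : Set (List A)} {u v p r : List A}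
    (h : factSet I K u = factSet I K v) (hu : TrEq I u (p ++ r)) :
    ∃ p' r', TrEq I v (p' ++ r') ∧ ctxSet K p = ctxSet K p' ∧ (∀ a, a ∈ p ↔ a ∈ p') ∧
      (∀ a, a ∈ r ↔ a ∈ r') := by
  have h1 : ((⟨ctxSet K p, p, rfl⟩, {a | a ∈ p}, {a | a ∈ r}) :
      Set.range (ctxSet K) × Set A × Set A) ∈ factSet I K u := ⟨p, r, hu, rfl⟩
  rw [h] at h1
  obtain ⟨p', r', h2, h3⟩ := h1
  simp only [Prod.mk.injEq] at h3
  exact ⟨p', r', h2, Subtype.ext_iff.1 h3.1, Set.ext_iff.1 h3.2.1, Set.ext_iff.1 h3.2.2⟩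

theorem factSet_ctx {I : A → A → Prop} {K : Set (List A)} (hK : TraceClosed I K) {u v : List A}
    (h : factSet I K u = factSet I K v) : ctxSet K u = ctxSet K v := by
  obtain ⟨p', r', h1, h2, -, h4⟩ := factSet_use (p := u) (r := []) h (by simpa using TrEq.refl' I _)
  have : r' = [] := List.eq_nil_iff_forall_not_mem.2 fun a ha => by simpa using (h4 a).2 ha
  subst this
  rw [h2, ctxSet_tr hK h1, List.append_nil]

theorem factSet_app_sub {I : A → A → Prop} (hsym : ∀ a b, I a b → I b a) {K : Set (List A)}
    (hK : TraceClosed I K) {u u' v v' : List A} (h : factSet I K u = factSet I K u')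
    (h' : factSet I K v = factSet I K v') : factSet I K (u ++ v) ⊆ factSet I K (u' ++ v') := by
  rintro t ⟨p, r, ht, rfl⟩
  obtain ⟨p1, r1, p2, r2, h1, h2, h3, h4, h5⟩ := TrEq.levi hsym ht
  obtain ⟨p1', r1', k1, k2, k3, k4⟩ := factSet_use h h1
  obtain ⟨p2', r2', l1, l2, l3, l4⟩ := factSet_use h' h2
  refine ⟨p1' ++ p2', r1' ++ r2', ?_, ?_⟩
  · have m1 := TrEq.app k1 l1
    have m2 := TrEq.ctx p1' r2' (TrEq.comm r1' p2' fun b hb a ha =>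
      h5 b ((k4 b).2 hb) a ((l3 a).2 ha))
    simp only [List.append_assoc] at m1 m2 ⊢
    exact m1.trans' m2
  · simp only [Prod.mk.injEq]
    refine ⟨Subtype.ext ((ctxSet_tr hK h3).trans (ctxSet_app k2 l2)), ?_, ?_⟩
    · ext a; simp [h3.perm.mem_iff, k3, l3]
    · ext a; simp [h4.perm.mem_iff, k4, l4]

theorem factSet_app {I : A → A → Prop} (hsym : ∀ a b, I a b → I b a) {K : Set (List A)}
    (hK : TraceClosed I K) {u u' v v' : List A} (h : factSet I K u = factSet I K u')
    (h' : factSet I K v = factSet I K v') : factSet I K (u ++ v) = factSet I K (u' ++ v') :=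
  (factSet_app_sub hsym hK h h').antisymm (factSet_app_sub hsym hK h.symm h'.symm)

theorem ctxSet_finite {K : Set (List A)} (hreg : RegularLang K) :
    Finite (Set.range (ctxSet K)) := by
  obtain ⟨σ, _, M, hM⟩ := hreg
  have : ∀ u, ctxSet K u = (fun f : σ → σ =>
      {t : List A × List A | M.evalFrom (f (M.evalFrom M.start t.1)) t.2 ∈ M.accept})
      (fun q => M.evalFrom q u) := by
    intro u
    ext ⟨x, y⟩
    simp only [ctxSet, Set.mem_ofPred_eq, ← hM, DFA.mem_accepts, DFA.eval, DFA.evalFrom_of_append]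
  refine Set.Finite.subset (Set.finite_range (fun f : σ → σ =>
      {t : List A × List A | M.evalFrom (f (M.evalFrom M.start t.1)) t.2 ∈ M.accept})) ?_
  rintro _ ⟨u, rfl⟩
  exact ⟨fun q => M.evalFrom q u, (this u).symm⟩

def factCon (I : A → A → Prop) (hsym : ∀ a b, I a b → I b a) (K : Set (List A))
    (hK : TraceClosed I K) : Con (FreeMonoid A) where
  r u v := factSet I K u.toList = factSet I K v.toList
  iseqv := ⟨fun _ => rfl, fun h => h.symm, fun h h' => h.trans h'⟩
  mul' h h' := by
    simp only [FreeMonoid.toList_mul]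
    exact factSet_app hsym hK h h'

theorem exists_monoid [Fintype A] (I : A → A → Prop) (hsym : ∀ a b, I a b → I b a)
    (K : Set (List A)) (hreg : RegularLang K) (hK : TraceClosed I K) :
    ∃ (S : Type) (_ : Fintype S) (_ : Monoid S) (φ : List A → S),
      IsHom φ ∧ ∀ u v, φ u = φ v ↔ factSet I K u = factSet I K v := by
  have := ctxSet_finite hreg
  let c := factCon I hsym K hK
  have : Finite c.Quotient := by
    refine Finite.of_injective (β := Set (Set.range (ctxSet K) × Set A × Set A))
      (fun q => Con.liftOn q (fun u => factSet I K u.toList) fun _ _ h => h) ?_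
    intro q q'
    induction q using Con.induction_on
    induction q' using Con.induction_on
    intro h
    exact (Con.eq c).2 h
  obtain ⟨n, ⟨e⟩⟩ := Finite.exists_equiv_fin c.Quotient
  refine ⟨Fin n, inferInstance, e.symm.monoid, fun u => e (FreeMonoid.ofList u : FreeMonoid A), ?_⟩
  letI := e.symm.monoid
  refine ⟨⟨?_, fun u v => ?_⟩, fun u v => ?_⟩
  · rfl
  · change e _ = e (e.symm (e _) * e.symm (e _))
    simp only [Equiv.symm_apply_apply, FreeMonoid.ofList_append, Con.coe_mul]
  · rw [e.apply_eq_iff_eq, Con.eq]; rfl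

theorem wpre_length (α : ℕ → A) (n : ℕ) : (wpre α n).length = n := by simp [wpre]

theorem wpre_add (α : ℕ → A) {n m : ℕ} (h : n ≤ m) : wpre α m = wpre α n ++ seg α n m := by
  obtain ⟨k, rfl⟩ := Nat.exists_eq_add_of_le h
  simp [wpre, seg, List.range_add, Function.comp_def]

theorem seg_add (α : ℕ → A) {i j k : ℕ} (h : i ≤ j) (h' : j ≤ k) :
    seg α i k = seg α i j ++ seg α j k := by
  apply List.append_cancel_left (as := wpre α i)
  rw [← wpre_add α (h.trans h'), ← List.append_assoc, ← wpre_add α h, ← wpre_add α h']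

theorem wpre_of_getElem (β : ℕ → A) (l : List A) (h : ∀ i (hi : i < l.length), l[i] = β i) :
    wpre β l.length = l := by
  apply List.ext_getElem
  · simp [wpre]
  · intro i h1 h2; simp [wpre, h i h2]

theorem TrPre.trans' {I : A → A → Prop} {u v w : List A} (h : TrPre I u v) (h' : TrPre I v w) :
    TrPre I u w := by
  obtain ⟨x, hx⟩ := h
  obtain ⟨y, hy⟩ := h'
  refine ⟨x ++ y, ?_⟩
  have := hx.app (TrEq.refl' I y)
  rw [List.append_assoc] at this
  exact this.trans' hy

theorem TrEq.pre {I : A → A → Prop} {u v : List A} (h : TrEq I u v) : TrPre I u v :=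
  ⟨[], by simpa using h⟩

theorem wpre_mono (I : A → A → Prop) (α : ℕ → A) {n m : ℕ} (h : n ≤ m) :
    TrPre I (wpre α n) (wpre α m) := ⟨seg α n m, by rw [← wpre_add α h]; exact EqvGen.refl _⟩

theorem lp_seg [Monoid S] {φ : List A → S} (hφ : IsHom φ) {e : S} (he : e * e = e) {α : ℕ → A}
    {n : ℕ → ℕ} (hn : StrictMono n) (h : ∀ i, φ (seg α (n i) (n (i + 1))) = e) (i : ℕ) :
    φ (seg α (n 0) (n (i + 1))) = e := by
  induction i with
  | zero => exact h 0
  | succ i ih =>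
    rw [seg_add α (hn.monotone (Nat.zero_le (i + 1))) (hn.monotone (Nat.le_succ (i + 1))), hφ.2,
      ih, h, he]

theorem step_one {I : A → A → Prop} (hirr : ∀ a, ¬ I a a) (hsym : ∀ a b, I a b → I b a)
    {K : Set (List A)} (hK : TraceClosed I K) [Monoid S] {φ : List A → S} (hφ : IsHom φ)
    {s e : S} (he : e * e = e) {α : ℕ → A} (hα : α ∈ LPWords φ s e)
    (hL : α ∈ omCl I (limL K)) :
    ∃ x w p r, φ x = s ∧ φ w = e ∧ TrEq I w (p ++ r) ∧ x ++ p ∈ K := by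
  obtain ⟨n, hn, h0, h1⟩ := hα
  obtain ⟨β, hβ, hab, hba⟩ := hL
  obtain ⟨m, hm⟩ := hab (n 0)
  obtain ⟨m', hm', hmK⟩ := hβ m
  obtain ⟨p, hp⟩ := hm.trans' (wpre_mono I β hm')
  obtain ⟨N, hN⟩ := hba m'
  have hNi : N ≤ n (N + 1) := (Nat.le_succ N).trans (hn.id_le _)
  obtain ⟨r, hr⟩ := hN.trans' (wpre_mono I α hNi)
  refine ⟨wpre α (n 0), seg α (n 0) (n (N + 1)), p, r, h0, lp_seg hφ he hn h1 N, ?_,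
    hK _ _ hmK hp.symm'⟩
  rw [wpre_add α (hn.monotone (Nat.zero_le (N + 1)))] at hr
  have h2 := (hp.app (TrEq.refl' I r)).trans' hr
  rw [List.append_assoc] at h2
  exact (TrEq.cancel hirr hsym _ h2).symm'

/-- Approximations of the rearranged word. -/
def bword (u : List A) (f : ℕ → List A) : ℕ → List A
  | 0 => u
  | k + 1 => bword u f k ++ f k

theorem bword_prefix (u : List A) (f : ℕ → List A) {k l : ℕ} (h : k ≤ l) :
    bword u f k <+: bword u f l := by
  induction h with
  | refl => exact List.prefix_refl _
  | step _ ih => exact ih.trans (List.prefix_append _ _)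

theorem step_two {I : A → A → Prop} {K : Set (List A)} (hK : TraceClosed I K) {α : ℕ → A}
    {n : ℕ → ℕ} (hn : StrictMono n) (h : ∀ k, ∃ p r, TrEq I (seg α (n k) (n (k + 1))) (p ++ r) ∧
      wpre α (n k) ++ p ∈ K) : α ∈ omCl I (limL K) := by
  choose p r hpr hpK using h
  set B := bword (wpre α (n 0)) (fun k => p k ++ r k) with hB
  have hBt : ∀ k, TrEq I (wpre α (n k)) (B k) := by
    intro k
    induction k with
    | zero => exact EqvGen.refl _
    | succ k ih =>
      rw [wpre_add α (hn.monotone (Nat.le_succ k))]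
      exact ih.app (hpr k)
  have hBl : ∀ k, (B k).length = n k := fun k => by
    rw [← (hBt k).perm.length_eq, wpre_length]
  let β : ℕ → A := fun m => (B (m + 1)).getD m (α m)
  have hlt : ∀ m, m < (B (m + 1)).length := fun m => by
    rw [hBl]; exact hn.id_le (m + 1)
  have hget : ∀ k i (hi : i < (B k).length), (B k)[i] = β i := by
    intro k i hi
    have h1 : β i = (B (i + 1))[i]'(hlt i) := by
      simp only [β]
      rw [List.getD_eq_getElem]
    rw [h1]
    rcases le_total k (i + 1) with hk | hk
    · exact (bword_prefix _ _ hk).getElem hi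
    · exact ((bword_prefix _ _ hk).getElem (hlt i)).symm
  have hpre : ∀ k, wpre β (n k) = B k := fun k => by
    rw [← hBl k]; exact wpre_of_getElem _ _ (hget k)
  have hpre2 : ∀ k, wpre β (B k ++ p k).length = B k ++ p k := by
    intro k
    apply wpre_of_getElem
    intro i hi
    have hp : B k ++ p k <+: B (k + 1) := ⟨r k, by simp [hB, bword]⟩
    rw [← hget (k + 1) i (lt_of_lt_of_le hi hp.length_le)]
    exact hp.getElem hi
  refine ⟨β, fun N => ⟨(B N ++ p N).length, ?_, ?_⟩, fun N => ⟨n N, ?_⟩, fun N => ⟨n N, ?_⟩⟩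
  · rw [List.length_append, hBl]; exact (hn.id_le N).trans (Nat.le_add_right _ _)
  · rw [hpre2]
    exact hK _ _ (hpK N) ((hBt N).app (TrEq.refl' I _))
  · rw [hpre]
    exact (wpre_mono I α (hn.id_le N)).trans' (hBt N).pre
  · have := (wpre_mono I β (hn.id_le N))
    rw [id, hpre] at this
    exact this.trans' (hBt N).symm'.pre

theorem stmt9 [Fintype A] (I : A → A → Prop)
    (hirr : ∀ a, ¬ I a a) (hsym : ∀ a b, I a b → I b a)
    (K : Set (List A)) (hreg : RegularLang K) (hK : TraceClosed I K) :
    ∃ (S : Type) (_ : Fintype S) (_ : Monoid S) (φ : List A → S) (P : Set S),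
      IsHom φ ∧ (∀ u v, TrEq I u v → φ u = φ v) ∧ K = φ ⁻¹' P ∧
      Saturates φ (omCl I (limL K)) := by
  obtain ⟨S, hS, hM, φ, hφ, hφe⟩ := exists_monoid I hsym K hreg hK
  refine ⟨S, hS, hM, φ, φ '' K, hφ, fun u v h => (hφe u v).2 (factSet_tr h), ?_, ?_⟩
  · ext u
    refine ⟨fun h => ⟨u, h, rfl⟩, ?_⟩
    rintro ⟨v, hv, hvu⟩
    exact (ctxSet_mem (factSet_ctx hK ((hφe v u).1 hvu))).1 hv
  · rintro s e ⟨hse, hee⟩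
    by_cases hne : LPWords φ s e ∩ omCl I (limL K) = ∅
    · exact Or.inl hne
    · right
      obtain ⟨α, hα, hL⟩ := Set.nonempty_iff_ne_empty.2 hne
      obtain ⟨x, w, p, r, hx, hw, hpr, hxp⟩ := step_one hirr hsym hK hφ hee hα hL
      rintro α' ⟨n, hn, h0, h1⟩
      refine step_two hK hn fun k => ?_
      obtain ⟨p', r', k1, k2, -, -⟩ := factSet_use ((hφe _ _).1 (hw.trans (h1 k).symm)) hpr
      refine ⟨p', r', k1, ?_⟩
      have hk : φ (wpre α' (n k)) = s := by
        cases k with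
        | zero => exact h0
        | succ k =>
          rw [wpre_add α' (hn.monotone (Nat.zero_le (k + 1))), hφ.2, h0, lp_seg hφ hee hn h1, hse]
      have hc := factSet_ctx hK ((hφe _ _).1 (hx.trans hk.symm))
      exact (ctxSet_mem (ctxSet_app hc k2)).1 hxp
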